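/- For every ε with 0 < ε < 1 there exist a constant c > 0 and an integer n₀ such that for every n ≥ n₀ there exists a DFA with n states and exactly 2 symbols, together with a subset S of its state set, such that S is synchronized by some word and the shortest word synchronizing S has length at least c · (3 − ε)^{n/3}; moreover the DFA can be chosen so that at most 2 of its states are sink states and it is transitive on the remaining states. -/

import Mathlib

/-- Action of a DFA transition function on a subset of states along a word. -/
def dfaRun {n m : ℕ} (δ : Fin n → Fin m → Fin n) :
    Finset (Fin n) → List (Fin m) → Finset (Fin n)
  | S, [] => S
  | S, a :: w => dfaRun δ (S.image fun q => δ q a) w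

/-- A word `w` synchronizes the subset `S` in the DFA `δ`. -/
def dfaSync {n m : ℕ} (δ : Fin n → Fin m → Fin n) (S : Finset (Fin n))
    (w : List (Fin m)) : Prop :=
  (dfaRun δ S w).card = 1

/-- `q` is a sink state of the DFA `δ`. -/
def dfaSink {n m : ℕ} (δ : Fin n → Fin m → Fin n) (q : Fin n) : Prop :=
  ∀ a, δ q a = q

instance {n m : ℕ} (δ : Fin n → Fin m → Fin n) : DecidablePred (dfaSink δ) :=
  fun _ => inferInstanceAs (Decidable (∀ _, _))

/-!
The automaton is a ternary counter. Its digits sit in `k + 1` groups arranged on a ring, one of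
which is empty and marks the position where the number starts. The letter `0` rotates the ring by
one group, and the letter `1` pushes the token in the head group along a chain of six states.
A control token forces each group to be treated by one of the words `0`, `10`, `1110`, `1111110`,
which respectively keep the digit, increment it, reset a maximal digit while keeping the carry, and
check that the group is empty.
-/

namespace TernaryCounter

/-- States of the counter with `k + 1` groups and `m` padding states. -/
inductive State (k m : ℕ) : Type
  | ring (i : Fin k) (u : Fin 3)
  | head (j : Fin 6)
  | idle (j : Fin 7)
  | carry (j : Fin 7)
  | pad (j : Fin m)
  | top
  | bot

namespace State

variable {k m : ℕ}

/-- The place of the digit `u` in the `i`-th group after the head. -/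
def slot : ℕ → Fin 3 → State k m
  | 0, u => head (u.castLE (by decide))
  | i + 1, u => if h : i < k then ring ⟨i, h⟩ u else bot

/-- The transition function of the counter. -/
def step : State k m → Fin 2 → State k m
  | ring i u, 0 => slot i u
  | ring i u, 1 => ring i u
  | head j, 0 => ![slot k 0, slot k 1, slot k 2, bot, carry 6, slot k 0] j
  | head j, 1 => ![head 1, head 2, head 3, head 4, head 5, bot] j
  | idle j, 0 => ![idle 0, bot, bot, bot, bot, bot, carry 0] j
  | idle j, 1 => ![idle 1, idle 2, idle 3, idle 4, idle 5, idle 6, bot] j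
  | carry j, 0 => ![bot, idle 0, bot, carry 0, bot, bot,
      if h : 0 < m then pad ⟨0, h⟩ else top] j
  | carry j, 1 => ![carry 1, carry 2, carry 3, carry 4, carry 5, carry 6, bot] j
  | pad j, 0 => if h : j.val + 1 < m then pad ⟨j.val + 1, h⟩ else top
  | pad j, 1 => if j.val = 0 then head 0 else idle 0
  | top, _ => top
  | bot, _ => bot

/-- The state reached from `q` along a word. -/
def run (q : State k m) (w : List (Fin 2)) : State k m := w.foldl step q

@[simp] lemma run_nil (q : State k m) : run q [] = q := rfl

@[simp] lemma run_cons (q : State k m) (x : Fin 2) (w : List (Fin 2)) :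
    run q (x :: w) = run (step q x) w := rfl

lemma run_append (q : State k m) (v w : List (Fin 2)) : run q (v ++ w) = run (run q v) w :=
  List.foldl_append

@[simp] lemma run_top (w : List (Fin 2)) : run (top : State k m) w = top := by
  induction w with
  | nil => rfl
  | cons x w ih => exact ih

@[simp] lemma run_bot (w : List (Fin 2)) : run (bot : State k m) w = bot := by
  induction w with
  | nil => rfl
  | cons x w ih => exact ih

lemma step_slot_succ_rotate {i : ℕ} (hi : i < k) (u : Fin 3) :
    step (slot (i + 1) u : State k m) 0 = slot i u := by
  simp [slot, hi, step]

lemma step_slot_succ_push {i : ℕ} (hi : i < k) (u : Fin 3) :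
    step (slot (i + 1) u : State k m) 1 = slot (i + 1) u := by
  simp [slot, hi, step]

lemma step_slot_zero_rotate (u : Fin 3) : step (slot 0 u : State k m) 0 = slot k u := by
  fin_cases u <;> rfl

/-- The word that pushes `j` times and then rotates. -/
def block (j : ℕ) : List (Fin 2) := List.replicate j 1 ++ [0]

lemma run_block_slot_succ {i : ℕ} (hi : i < k) (u : Fin 3) (j : ℕ) (w : List (Fin 2)) :
    run (slot (i + 1) u : State k m) (block j ++ w) = run (slot i u) w := by
  induction j with
  | zero => simp [block, step_slot_succ_rotate hi]
  | succ j ih =>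
    simpa [block, List.replicate_succ, step_slot_succ_push hi] using ih

lemma run_rotate_slot (i : ℕ) {j : ℕ} (h : i + j ≤ k) (u : Fin 3) :
    run (slot (i + j) u : State k m) (List.replicate j 0) = slot i u := by
  induction j with
  | zero => rfl
  | succ j ih =>
    rw [List.replicate_succ, run_cons, ← Nat.add_assoc,
      step_slot_succ_rotate (by omega), ih (by omega)]

lemma run_full_rotation {i : ℕ} (hi : i ≤ k) (u : Fin 3) :
    run (slot i u : State k m) (List.replicate (k + 1) 0) = slot i u := by
  have h : List.replicate (k + 1) (0 : Fin 2) =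
      List.replicate i 0 ++ 0 :: List.replicate (k - i) 0 := by
    rw [← List.replicate_succ, ← List.replicate_add]
    congr 1
    omega
  have h0 := run_rotate_slot (k := k) (m := m) 0 (j := i) (by omega) u
  have h1 := run_rotate_slot (k := k) (m := m) i (j := k - i) (by omega) u
  rw [Nat.zero_add] at h0
  rw [Nat.add_sub_cancel' hi] at h1
  rw [h, run_append, h0, run_cons, step_slot_zero_rotate, h1]

/-- All digits of `l`, placed in consecutive groups from the `s`-th on, satisfy `P`. -/
def Placed (P : State k m → Prop) : ℕ → List (Fin 3) → Prop
  | _, [] => True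
  | s, x :: l => P (slot s x) ∧ Placed P (s + 1) l

lemma placed_append_singleton (P : State k m → Prop) (s : ℕ) (l : List (Fin 3)) (x : Fin 3) :
    Placed P s (l ++ [x]) ↔ Placed P s l ∧ P (slot (s + l.length) x) := by
  induction l generalizing s with
  | nil => simp [Placed]
  | cons y l ih =>
    simp only [List.cons_append, Placed, ih, List.length_cons, and_assoc]
    rw [show s + 1 + l.length = s + (l.length + 1) by omega]

lemma Placed.imp {P Q : State k m → Prop} {s t : ℕ} {l : List (Fin 3)}
    (h : ∀ i < l.length, ∀ u, P (slot (s + i) u) → Q (slot (t + i) u))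
    (hP : Placed P s l) : Placed Q t l := by
  induction l generalizing s t with
  | nil => trivial
  | cons y l ih =>
    refine ⟨h 0 (by simp) y hP.1, ih (fun i hi u => ?_) hP.2⟩
    have := h (i + 1) (by simpa using hi) u
    rwa [show s + 1 + i = s + (i + 1) by omega, show t + 1 + i = t + (i + 1) by omega]

/-- The word `w` takes every digit of the counter to `top`, where `A` lists the digits from the head
up to the empty group and `B` those after the empty group. -/
def Accepts (k m : ℕ) (w : List (Fin 2)) (A B : List (Fin 3)) : Prop :=
  Placed (fun q : State k m => run q w = top) 0 A ∧
    Placed (fun q : State k m => run q w = top) (A.length + 1) B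

lemma accepts_block_nil {j : ℕ} {w : List (Fin 2)} {B : List (Fin 3)} (hB : B.length = k) :
    Accepts k m (block j ++ w) [] B ↔ Accepts k m w B [] := by
  constructor
  · rintro ⟨-, h⟩
    refine ⟨h.imp fun i hi u hu => ?_, trivial⟩
    rw [← run_block_slot_succ (by omega) u j w]
    simpa [Nat.add_comm] using hu
  · rintro ⟨h, -⟩
    refine ⟨trivial, h.imp fun i hi u hu => ?_⟩
    rw [← run_block_slot_succ (by omega) u j w] at hu
    simpa [Nat.add_comm] using hu

lemma accepts_block_cons {j : ℕ} {w : List (Fin 2)} {x y : Fin 3} {A B : List (Fin 3)}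
    (hAB : (x :: A).length + B.length = k)
    (hxy : run (slot 0 x : State k m) (block j ++ w) = run (slot k y) w) :
    Accepts k m (block j ++ w) (x :: A) B ↔ Accepts k m w A (B ++ [y]) := by
  have hk : A.length + 1 + B.length = k := by simpa using hAB
  unfold Accepts
  rw [placed_append_singleton, hk]
  constructor
  · rintro ⟨⟨h0, hA⟩, hB⟩
    refine ⟨hA.imp fun i hi u hu => ?_, hB.imp fun i hi u hu => ?_, hxy ▸ h0⟩
    · rw [← run_block_slot_succ (by omega) u j w]
      simpa [Nat.add_comm] using hu
    · rw [← run_block_slot_succ (by omega) u j w]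
      simpa [Nat.add_right_comm] using hu
  · rintro ⟨hA, hB, h0⟩
    refine ⟨⟨hxy.trans h0, hA.imp fun i hi u hu => ?_⟩, hB.imp fun i hi u hu => ?_⟩
    · rw [← run_block_slot_succ (by omega) u j w] at hu
      simpa [Nat.add_comm] using hu
    · rw [← run_block_slot_succ (by omega) u j w] at hu
      simpa [Nat.add_right_comm] using hu

/-- The value of a list of ternary digits, least significant digit first. -/
def value (l : List (Fin 3)) : ℕ := Nat.ofDigits 3 (l.map Fin.val)

lemma value_append_cons (B A : List (Fin 3)) (x : Fin 3) :
    value (B ++ x :: A) = value B + 3 ^ B.length * (x + 3 * value A) := by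
  simp [value, Nat.ofDigits_append, Nat.ofDigits_cons]

lemma value_lt (l : List (Fin 3)) : value l < 3 ^ l.length := by
  have := Nat.ofDigits_lt_base_pow_length (b := 3) (l := l.map Fin.val) (by decide)
    (by simp)
  simpa [value] using this

lemma val_add_one {x : Fin 3} (hx : x ≠ 2) : ((x + 1 : Fin 3) : ℕ) = x + 1 := by
  revert x
  decide

lemma exists_cons_of_run_eq_top {q : State k m} {w : List (Fin 2)} (hq : q ≠ top)
    (h : run q w = top) :
    (∃ v, w = 0 :: v ∧ run (step q 0) v = top) ∨ ∃ v, w = 1 :: v ∧ run (step q 1) v = top := by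
  match w, h with
  | [], h => exact absurd h hq
  | 0 :: v, h => exact .inl ⟨v, rfl, h⟩
  | 1 :: v, h => exact .inr ⟨v, rfl, h⟩

lemma exists_push_of_run_eq_top {q : State k m} {w : List (Fin 2)} (hq : q ≠ top)
    (h0 : step q 0 = bot) (h : run q w = top) :
    ∃ v, w = 1 :: v ∧ run (step q 1) v = top := by
  rcases exists_cons_of_run_eq_top hq h with ⟨v, -, hv⟩ | hv
  · simp [h0] at hv
  · exact hv

lemma exists_rotate_of_run_eq_top {q : State k m} {w : List (Fin 2)} (hq : q ≠ top)
    (h1 : step q 1 = bot) (h : run q w = top) :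
    ∃ v, w = 0 :: v ∧ run (step q 0) v = top := by
  rcases exists_cons_of_run_eq_top hq h with hv | ⟨v, -, hv⟩
  · exact hv
  · simp [h1] at hv

lemma run_idle_eq_top {w : List (Fin 2)} (h : run (idle 0 : State k m) w = top) :
    (∃ v, w = block 0 ++ v ∧ run (idle 0 : State k m) v = top) ∨
      ∃ v, w = block 6 ++ v ∧ run (carry 0 : State k m) v = top := by
  rcases exists_cons_of_run_eq_top (q := idle 0) nofun h with h | ⟨w, rfl, h⟩
  · exact .inl h
  obtain ⟨w, rfl, h⟩ := exists_push_of_run_eq_top (q := idle 1) nofun rfl h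
  obtain ⟨w, rfl, h⟩ := exists_push_of_run_eq_top (q := idle 2) nofun rfl h
  obtain ⟨w, rfl, h⟩ := exists_push_of_run_eq_top (q := idle 3) nofun rfl h
  obtain ⟨w, rfl, h⟩ := exists_push_of_run_eq_top (q := idle 4) nofun rfl h
  obtain ⟨w, rfl, h⟩ := exists_push_of_run_eq_top (q := idle 5) nofun rfl h
  obtain ⟨w, rfl, h⟩ := exists_rotate_of_run_eq_top (q := idle 6) nofun rfl h
  exact .inr ⟨w, rfl, h⟩

lemma run_carry_eq_top {w : List (Fin 2)} (h : run (carry 0 : State k m) w = top) :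
    (∃ v, w = block 1 ++ v ∧ run (idle 0 : State k m) v = top) ∨
      (∃ v, w = block 3 ++ v ∧ run (carry 0 : State k m) v = top) ∨
      ∃ v, w = block 6 ++ v := by
  obtain ⟨w, rfl, h⟩ := exists_push_of_run_eq_top (q := carry 0) nofun rfl h
  rcases exists_cons_of_run_eq_top (q := carry 1) nofun h with ⟨w, rfl, h⟩ | ⟨w, rfl, h⟩
  · exact .inl ⟨w, rfl, h⟩
  obtain ⟨w, rfl, h⟩ := exists_push_of_run_eq_top (q := carry 2) nofun rfl h
  rcases exists_cons_of_run_eq_top (q := carry 3) nofun h with ⟨w, rfl, h⟩ | ⟨w, rfl, h⟩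
  · exact .inr (.inl ⟨w, rfl, h⟩)
  obtain ⟨w, rfl, h⟩ := exists_push_of_run_eq_top (q := carry 4) nofun rfl h
  obtain ⟨w, rfl, h⟩ := exists_push_of_run_eq_top (q := carry 5) nofun rfl h
  obtain ⟨w, rfl, h⟩ := exists_rotate_of_run_eq_top (q := carry 6) nofun rfl h
  exact .inr (.inr ⟨w, rfl⟩)

lemma run_slot_zero_block_six (x : Fin 3) (w : List (Fin 2)) :
    run (slot 0 x : State k m) (block 6 ++ w) = bot := by
  rw [run_append]
  convert run_bot w using 2
  fin_cases x <;> rfl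

lemma run_slot_zero_block_one (x : Fin 3) (w : List (Fin 2)) :
    run (slot 0 x : State k m) (block 1 ++ w) =
      if x = 2 then bot else run (slot k (x + 1)) w := by
  rw [run_append]
  fin_cases x
  · rfl
  · rfl
  · exact run_bot w

/-- A carry that meets a digit `1` turns it into a control token that the carry destroys. -/
lemma eq_two_of_run_slot_zero_block_three {x : Fin 3} {w : List (Fin 2)}
    (h : run (slot 0 x : State k m) (block 3 ++ w) = top)
    (hw : run (carry 0 : State k m) w = top) : x = 2 := by
  rw [run_append] at h
  fin_cases x
  · exact absurd ((run_bot w).symm.trans h) nofun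
  · obtain ⟨v, rfl, -⟩ := exists_push_of_run_eq_top (q := carry 0) nofun rfl hw
    exact absurd ((run_bot v).symm.trans h) nofun
  · rfl

/-- The lower bound: each word that empties the counter counts through all remaining values. -/
theorem three_pow_le_length_add (n : ℕ) (w : List (Fin 2)) (hn : w.length ≤ n)
    (A B : List (Fin 3)) (hAB : A.length + B.length = k) (hw : Accepts k m w A B) :
    (run (idle 0 : State k m) w = top → 3 ^ k ≤ w.length + value (B ++ A)) ∧
      (run (carry 0 : State k m) w = top →
        3 ^ k ≤ w.length + value (B ++ A) + 3 ^ B.length) := by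
  induction n generalizing w A B with
  | zero =>
    obtain rfl := List.length_eq_zero_iff.mp (Nat.le_zero.mp hn)
    exact ⟨nofun, nofun⟩
  | succ n ih =>
    constructor
    · intro h
      rcases run_idle_eq_top h with ⟨v, rfl, hv⟩ | ⟨v, rfl, hv⟩
      · have hl : v.length ≤ n := by simp [block] at hn; omega
        cases A with
        | nil =>
          have := (ih v hl B [] (by simpa using hAB)
            ((accepts_block_nil (by simpa using hAB)).mp hw)).1 hv
          simp [block] at this ⊢
          omega
        | cons x A =>
          have hx : run (slot 0 x : State k m) (block 0 ++ v) = run (slot k x) v := by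
            rw [← step_slot_zero_rotate]; rfl
          have := (ih v hl A (B ++ [x]) (by simp at hAB ⊢; omega)
            ((accepts_block_cons hAB hx).mp hw)).1 hv
          simp [block] at this ⊢
          omega
      · have hl : v.length ≤ n := by simp [block] at hn; omega
        cases A with
        | nil =>
          have := (ih v hl B [] (by simpa using hAB)
            ((accepts_block_nil (by simpa using hAB)).mp hw)).2 hv
          simp [block] at this ⊢
          omega
        | cons x A =>
          exact absurd ((run_slot_zero_block_six x v).symm.trans hw.1.1) nofun
    · intro h
      cases A with
      | nil =>
        have : B.length = k := by simpa using hAB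
        rw [this]
        omega
      | cons x A =>
        rcases run_carry_eq_top h with ⟨v, rfl, hv⟩ | ⟨v, rfl, hv⟩ | ⟨v, rfl⟩
        · have hl : v.length ≤ n := by simp [block] at hn; omega
          have hx := run_slot_zero_block_one (k := k) (m := m) x v
          split_ifs at hx with hx2
          · exact absurd (hx.symm.trans hw.1.1) nofun
          have := (ih v hl A (B ++ [x + 1]) (by simp at hAB ⊢; omega)
            ((accepts_block_cons hAB hx).mp hw)).1 hv
          rw [List.append_assoc, List.singleton_append, value_append_cons,
            val_add_one hx2] at this
          rw [value_append_cons]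
          simp [block]
          linarith
        · have hl : v.length ≤ n := by simp [block] at hn; omega
          obtain rfl := eq_two_of_run_slot_zero_block_three hw.1.1 hv
          have hx : run (slot 0 2 : State k m) (block 3 ++ v) = run (slot k 0) v := rfl
          have := (ih v hl A (B ++ [0]) (by simp at hAB ⊢; omega)
            ((accepts_block_cons hAB hx).mp hw)).2 hv
          rw [List.append_assoc, List.singleton_append, value_append_cons] at this
          rw [value_append_cons]
          simp [block, pow_succ] at this ⊢
          linarith
        · exact absurd ((run_slot_zero_block_six x v).symm.trans hw.1.1) nofun

lemma run_pad : ∀ (d : ℕ) (j : Fin m), m ≤ j + d →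
    run (pad j : State k m) (List.replicate d 0) = top := by
  intro d
  induction d with
  | zero => intro j hj; omega
  | succ d ih =>
    intro j hj
    rw [List.replicate_succ, run_cons, step]
    split_ifs with h
    · exact ih _ (by simp; omega)
    · exact run_top _

lemma run_carry_six {d : ℕ} (hd : m ≤ d) :
    run (carry 6 : State k m) (List.replicate (d + 1) 0) = top := by
  rw [List.replicate_succ, run_cons]
  change run (if h : 0 < m then pad ⟨0, h⟩ else top) _ = _
  split_ifs with h
  · exact run_pad d ⟨0, h⟩ (by simpa using hd)
  · exact run_top _

/-- Once the control token has left, the digits can be removed one at a time. -/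
lemma exists_placed (hm : m ≤ k) (l : List (Fin 3)) (hl : l.length ≤ k) :
    ∃ w, Placed (fun q : State k m => run q w = top) 0 l := by
  induction l with
  | nil => exact ⟨[], trivial⟩
  | cons x l ih =>
    simp only [List.length_cons] at hl
    obtain ⟨w, hw⟩ := ih (by omega)
    refine ⟨block (4 - x) ++ (List.replicate (k + 1) 0 ++ w), ?_, hw.imp fun i hi u hu => ?_⟩
    · have h : run (slot 0 x : State k m) (block (4 - x)) = carry 6 := by
        fin_cases x <;> rfl
      simp only [run_append, h, run_carry_six hm, run_top]
    · rw [Nat.zero_add, Nat.add_comm, run_block_slot_succ (by omega), run_append,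
        run_full_rotation (by omega)]
      simpa using hu

lemma exists_idle_of_nil {A B : List (Fin 3)} (hAB : A.length + B.length = k)
    (h : ∃ w, run (idle 0 : State k m) w = top ∧ Accepts k m w [] (B ++ A)) :
    ∃ w, run (idle 0 : State k m) w = top ∧ Accepts k m w A B := by
  induction A generalizing B with
  | nil => simpa using h
  | cons x A ih =>
    obtain ⟨w, hw, hA⟩ := ih (B := B ++ [x]) (by simp at hAB ⊢; omega) (by simpa using h)
    have hx : run (slot 0 x : State k m) (block 0 ++ w) = run (slot k x) w := by
      rw [← step_slot_zero_rotate]; rfl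
    exact ⟨block 0 ++ w, hw, (accepts_block_cons hAB hx).mpr hA⟩

lemma exists_carry_of_nil (hm : m ≤ k) {A B : List (Fin 3)} (hAB : A.length + B.length = k)
    (h : ∀ C : List (Fin 3), C.length = k → value C = value (B ++ A) + 3 ^ B.length →
      ∃ w, run (idle 0 : State k m) w = top ∧ Accepts k m w [] C) :
    ∃ w, run (carry 0 : State k m) w = top ∧ Accepts k m w A B := by
  induction A generalizing B with
  | nil =>
    have hB : B.length = k := by simpa using hAB
    obtain ⟨w, hw⟩ := exists_placed (m := m) hm B hB.le
    refine ⟨block 6 ++ (List.replicate (k + 1) 0 ++ w), ?_, (accepts_block_nil hB).mpr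
      ⟨hw.imp fun i hi u hu => ?_, trivial⟩⟩
    · have : run (carry 0 : State k m) (List.replicate 6 1) = carry 6 := rfl
      have hw : block 6 ++ (List.replicate (k + 1) 0 ++ w) =
          List.replicate 6 1 ++ (List.replicate (k + 1 + 1) 0 ++ w) := by
        simp [block, List.replicate_succ]
      rw [hw, run_append, this, run_append, run_carry_six (by omega), run_top]
    · rw [run_append, run_full_rotation (by omega)]
      exact hu
  | cons x A ih =>
    by_cases hx2 : x = 2
    · subst hx2
      obtain ⟨w, hw, hA⟩ := ih (B := B ++ [0]) (by simp at hAB ⊢; omega) (by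
        intro C hC hv
        refine h C hC (hv.trans ?_)
        rw [List.append_assoc, List.singleton_append, value_append_cons, value_append_cons]
        simp [pow_succ]
        ring)
      exact ⟨block 3 ++ w, hw, (accepts_block_cons hAB rfl).mpr hA⟩
    · obtain ⟨w, hw, hA⟩ := exists_idle_of_nil (m := m) (A := A) (B := B ++ [x + 1])
        (by simp at hAB ⊢; omega) (h _ (by simp at hAB ⊢; omega) (by
          rw [List.append_assoc, List.singleton_append, value_append_cons, value_append_cons,
            val_add_one hx2]
          ring))
      have hx := run_slot_zero_block_one (k := k) (m := m) x w
      rw [if_neg hx2] at hx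
      exact ⟨block 1 ++ w, hw, (accepts_block_cons hAB hx).mpr hA⟩

lemma exists_idle (hm : m ≤ k) (r : ℕ) (B : List (Fin 3)) (hB : B.length = k)
    (hr : 3 ^ k ≤ r + value B) :
    ∃ w, run (idle 0 : State k m) w = top ∧ Accepts k m w [] B := by
  induction r generalizing B with
  | zero =>
    have := value_lt B
    rw [hB] at this
    omega
  | succ r ih =>
    obtain ⟨w, hw, hA⟩ := exists_carry_of_nil (m := m) hm (A := B) (B := []) (by simpa using hB)
      (fun C hC hv => ih C hC (by simp at hv; omega))
    exact ⟨block 6 ++ w, hw, (accepts_block_nil hB).mpr hA⟩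

/-- Some word leads from `q` to `r`. -/
def Reaches (q r : State k m) : Prop := ∃ w, run q w = r

lemma Reaches.trans {q r s : State k m} : Reaches q r → Reaches r s → Reaches q s := by
  rintro ⟨v, rfl⟩ ⟨w, rfl⟩
  exact ⟨v ++ w, run_append q v w⟩

lemma reaches_step (q : State k m) (x : Fin 2) : Reaches q (step q x) := ⟨[x], rfl⟩

lemma reaches_head {i j : Fin 6} (h : i ≤ j) : Reaches (head i : State k m) (head j) := by
  refine ⟨List.replicate (j - i) 1, ?_⟩
  revert h
  fin_cases i <;> fin_cases j <;> first | (intro; rfl) | (intro h; exact absurd h (by decide))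

lemma reaches_idle {i j : Fin 7} (h : i ≤ j) : Reaches (idle i : State k m) (idle j) := by
  refine ⟨List.replicate (j - i) 1, ?_⟩
  revert h
  fin_cases i <;> fin_cases j <;> first | (intro; rfl) | (intro h; exact absurd h (by decide))

lemma reaches_carry {i j : Fin 7} (h : i ≤ j) : Reaches (carry i : State k m) (carry j) := by
  refine ⟨List.replicate (j - i) 1, ?_⟩
  revert h
  fin_cases i <;> fin_cases j <;> first | (intro; rfl) | (intro h; exact absurd h (by decide))

lemma slot_val_succ (i : Fin k) (u : Fin 3) : (slot (i + 1) u : State k m) = ring i u := by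
  simp [slot]

lemma reaches_ring_head (i : Fin k) (u : Fin 3) :
    Reaches (ring i u : State k m) (head (u.castLE (by decide))) := by
  have h := run_rotate_slot (k := k) (m := m) 0 (j := i + 1) (by omega) u
  rw [Nat.zero_add, slot_val_succ] at h
  exact ⟨_, h⟩

lemma reaches_head_ring (i : Fin k) (u : Fin 3) :
    Reaches (head (u.castLE (by decide)) : State k m) (ring i u) := by
  have h := run_rotate_slot (k := k) (m := m) (i + 1) (j := k - (i + 1)) (by omega) u
  rw [show (i : ℕ) + 1 + (k - (i + 1)) = k by omega, slot_val_succ] at h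
  exact (step_slot_zero_rotate (k := k) (m := m) u ▸ reaches_step _ 0 :
    Reaches (slot 0 u : State k m) (slot k u)).trans ⟨_, h⟩

lemma reaches_head_five_head_zero : Reaches (head 5 : State k m) (head 0) := by
  have h := run_rotate_slot (k := k) (m := m) 0 (j := k) (by omega) 0
  rw [Nat.zero_add] at h
  exact (reaches_step (head 5) 0).trans ⟨_, h⟩

lemma reaches_carry_six_pad_zero (hm : 0 < m) :
    Reaches (carry 6 : State k m) (pad ⟨0, hm⟩) := by
  have h := reaches_step (carry 6 : State k m) 0
  rwa [show step (carry 6 : State k m) 0 = if h : 0 < m then pad ⟨0, h⟩ else top from rfl,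
    dif_pos hm] at h

lemma reaches_pad (hm : 0 < m) (j : ℕ) (hj : j < m) :
    Reaches (pad ⟨0, hm⟩ : State k m) (pad ⟨j, hj⟩) := by
  induction j with
  | zero => exact ⟨[], rfl⟩
  | succ j ih =>
    refine (ih (by omega)).trans ?_
    have h := reaches_step (pad ⟨j, by omega⟩ : State k m) 0
    rwa [step, dif_pos hj] at h

lemma reaches_head_zero (hm : 0 < m) (q : State k m) (ht : q ≠ top) (hb : q ≠ bot) :
    Reaches q (head 0) := by
  have hhead (j : Fin 6) : Reaches (head j : State k m) (head 0) :=
    (reaches_head (Fin.le_last j)).trans reaches_head_five_head_zero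
  have hcarry (j : Fin 7) : Reaches (carry j : State k m) (head 0) :=
    ((reaches_carry (Fin.le_last j)).trans (reaches_carry_six_pad_zero hm)).trans
      (reaches_step _ 1)
  have hidle (j : Fin 7) : Reaches (idle j : State k m) (head 0) :=
    ((reaches_idle (Fin.le_last j)).trans (reaches_step (idle 6) 0)).trans (hcarry 0)
  match q with
  | ring i u => exact (reaches_ring_head i u).trans (hhead _)
  | head j => exact hhead j
  | idle j => exact hidle j
  | carry j => exact hcarry j
  | pad j =>
    refine (reaches_step _ 1).trans ?_
    rw [step]
    split_ifs
    · exact hhead 0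
    · exact hidle 0
  | top => exact absurd rfl ht
  | bot => exact absurd rfl hb

lemma head_zero_reaches (hm : 1 < m) (q : State k m) (ht : q ≠ top) (hb : q ≠ bot) :
    Reaches (head 0) q := by
  have hhead (j : Fin 6) : Reaches (head 0 : State k m) (head j) := reaches_head (Fin.zero_le j)
  have hpad (j : Fin m) : Reaches (head 0 : State k m) (pad j) :=
    (((hhead 4).trans (reaches_step (head 4) 0)).trans
      (reaches_carry_six_pad_zero (by omega))).trans (reaches_pad _ j j.isLt)
  have hidle (j : Fin 7) : Reaches (head 0 : State k m) (idle j) :=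
    ((hpad ⟨1, hm⟩).trans (reaches_step _ 1)).trans (reaches_idle (Fin.zero_le j))
  match q with
  | ring i u => exact (hhead _).trans (reaches_head_ring i u)
  | head j => exact hhead j
  | idle j => exact hidle j
  | carry j =>
    exact ((hidle 6).trans (reaches_step (idle 6) 0)).trans (reaches_carry (Fin.zero_le j))
  | pad j => exact hpad j
  | top => exact absurd rfl ht
  | bot => exact absurd rfl hb

lemma eq_top_or_eq_bot_of_sink {q : State k m} (h : ∀ x, step q x = q) : q = top ∨ q = bot := by
  match q, h with
  | ring i u, h =>
    have h0 := h 0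
    obtain ⟨_ | i, hi⟩ := i
    · simp [step, slot] at h0
    · have hi' : i < k := by omega
      simp [step, slot, hi'] at h0
  | head j, h => fin_cases j <;> exact absurd (h 1) (by simp [step])
  | idle j, h => fin_cases j <;> exact absurd (h 1) (by simp [step])
  | carry j, h => fin_cases j <;> exact absurd (h 1) (by simp [step])
  | pad j, h =>
    have h0 := h 0
    rw [step] at h0
    split_ifs at h0
    · simp [Fin.ext_iff] at h0
  | top, _ => exact .inl rfl
  | bot, _ => exact .inr rfl

/-- The states of the counter as a disjoint union. -/
def equivSum (k m : ℕ) :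
    State k m ≃ (Fin k × Fin 3) ⊕ Fin 6 ⊕ Fin 7 ⊕ Fin 7 ⊕ Fin m ⊕ Bool where
  toFun
    | ring i u => .inl (i, u)
    | head j => .inr (.inl j)
    | idle j => .inr (.inr (.inl j))
    | carry j => .inr (.inr (.inr (.inl j)))
    | pad j => .inr (.inr (.inr (.inr (.inl j))))
    | top => .inr (.inr (.inr (.inr (.inr true))))
    | bot => .inr (.inr (.inr (.inr (.inr false))))
  invFun
    | .inl (i, u) => ring i u
    | .inr (.inl j) => head j
    | .inr (.inr (.inl j)) => idle j
    | .inr (.inr (.inr (.inl j))) => carry j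
    | .inr (.inr (.inr (.inr (.inl j)))) => pad j
    | .inr (.inr (.inr (.inr (.inr true)))) => top
    | .inr (.inr (.inr (.inr (.inr false)))) => bot
  left_inv q := by cases q <;> rfl
  right_inv q := by rcases q with _ | _ | _ | _ | _ | _ | _ <;> rfl

lemma nonempty_equiv_fin (k m : ℕ) : Nonempty (State k m ≃ Fin (3 * k + 22 + m)) := by
  refine ⟨(equivSum k m).trans (Fintype.equivFinOfCardEq ?_)⟩
  simp
  ring

/-- The initial tokens: the control token, a zero in each nonempty group, and the target `top`. -/
def initial (k m : ℕ) : Set (State k m) :=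
  {q | q = top ∨ q = idle 0 ∨ ∃ i < k, q = slot (i + 1) 0}

lemma top_mem_initial : (top : State k m) ∈ initial k m := .inl rfl

lemma placed_replicate (P : State k m → Prop) (s n : ℕ) (x : Fin 3) :
    Placed P s (List.replicate n x) ↔ ∀ i < n, P (slot (s + i) x) := by
  induction n generalizing s with
  | zero => simp [Placed]
  | succ n ih =>
    rw [List.replicate_succ, Placed, ih, Nat.forall_lt_succ_left]
    simp [Nat.add_assoc, Nat.add_comm 1]

lemma forall_initial_iff (w : List (Fin 2)) :
    (∀ q ∈ initial k m, run q w = top) ↔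
      run (idle 0 : State k m) w = top ∧ Accepts k m w [] (List.replicate k 0) := by
  simp only [Accepts, placed_replicate, initial, Set.mem_ofPred_eq, Placed, true_and,
    List.length_nil, Nat.zero_add]
  constructor
  · intro h
    exact ⟨h _ (.inr (.inl rfl)), fun i hi => h _ (.inr (.inr ⟨i, hi, by rw [Nat.add_comm]⟩))⟩
  · rintro ⟨h0, h⟩ q (rfl | rfl | ⟨i, hi, rfl⟩)
    · exact run_top w
    · exact h0
    · rw [Nat.add_comm]
      exact h i hi

lemma value_replicate_zero (n : ℕ) : value (List.replicate n 0) = 0 := by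
  induction n with
  | zero => rfl
  | succ n ih => simp_all [value, List.replicate_succ, Nat.ofDigits_cons]

end State

open State

/-- The transition function of the counter on states renumbered by `e`. -/
def renumber {k m n : ℕ} (e : State k m ≃ Fin n) (q : Fin n) (x : Fin 2) : Fin n :=
  e (step (e.symm q) x)

lemma dfaRun_renumber {k m n : ℕ} (e : State k m ≃ Fin n) (S : Finset (Fin n))
    (w : List (Fin 2)) :
    dfaRun (renumber e) S w = S.image fun q => e (run (e.symm q) w) := by
  induction w generalizing S with
  | nil => simp [dfaRun]
  | cons x w ih =>
    rw [dfaRun, ih, Finset.image_image]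
    simp [Function.comp_def, renumber]

lemma dfaSink_renumber {k m n : ℕ} (e : State k m ≃ Fin n) (q : Fin n) :
    dfaSink (renumber e) q ↔ e.symm q = top ∨ e.symm q = bot := by
  have h : dfaSink (renumber e) q ↔ ∀ x, step (e.symm q) x = e.symm q :=
    forall_congr' fun x => e.eq_symm_apply.symm
  rw [h]
  refine ⟨eq_top_or_eq_bot_of_sink, ?_⟩
  rintro (h | h) x <;> rw [h] <;> rfl

open Classical in
lemma dfaSync_renumber {k m n : ℕ} (e : State k m ≃ Fin n) (w : List (Fin 2)) :
    dfaSync (renumber e) (Finset.univ.filter fun q => e.symm q ∈ initial k m) w ↔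
      ∀ q ∈ initial k m, run q w = top := by
  rw [dfaSync, dfaRun_renumber, Finset.card_eq_one]
  constructor
  · rintro ⟨a, ha⟩ q hq
    have hmem (r : State k m) (hr : r ∈ initial k m) : e (run r w) = a := by
      rw [← Finset.mem_singleton, ← ha]
      exact Finset.mem_image.mpr ⟨e r, by simpa using hr, by simp⟩
    have htop := hmem top top_mem_initial
    rw [run_top] at htop
    exact e.injective ((hmem q hq).trans htop.symm)
  · intro h
    refine ⟨e top, Finset.eq_singleton_iff_unique_mem.mpr ⟨?_, ?_⟩⟩
    · exact Finset.mem_image.mpr ⟨e top, by simpa using top_mem_initial, by simp⟩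
    · simp only [Finset.mem_image, Finset.mem_filter, Finset.mem_univ, true_and]
      rintro _ ⟨q, hq, rfl⟩
      rw [h _ hq]

theorem exists_dfa (k m : ℕ) (hm : 1 < m) (hmk : m ≤ k) :
    ∃ (δ : Fin (3 * k + 22 + m) → Fin 2 → Fin (3 * k + 22 + m))
      (S : Finset (Fin (3 * k + 22 + m))),
      (∃ w, dfaSync δ S w) ∧ (∀ w, dfaSync δ S w → 3 ^ k ≤ w.length) ∧
      (Finset.univ.filter fun q => dfaSink δ q).card ≤ 2 ∧
      ∀ q q', ¬ dfaSink δ q → ¬ dfaSink δ q' → ∃ w, dfaRun δ {q} w = {q'} := by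
  classical
  obtain ⟨e⟩ := nonempty_equiv_fin k m
  refine ⟨renumber e, Finset.univ.filter fun q => e.symm q ∈ initial k m, ?_, ?_, ?_, ?_⟩
  · obtain ⟨w, hw⟩ := exists_idle (m := m) hmk (3 ^ k) (List.replicate k 0) (by simp) (by omega)
    exact ⟨w, (dfaSync_renumber e w).mpr ((forall_initial_iff w).mpr hw)⟩
  · intro w hw
    obtain ⟨h, hA⟩ := (forall_initial_iff w).mp ((dfaSync_renumber e w).mp hw)
    simpa [value_replicate_zero] using
      (three_pow_le_length_add w.length w le_rfl [] _ (by simp) hA).1 h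
  · refine (Finset.card_le_card (t := {e top, e bot}) fun q hq => ?_).trans Finset.card_le_two
    simpa [dfaSink_renumber, Equiv.symm_apply_eq] using hq
  · intro q q' hq hq'
    rw [dfaSink_renumber, not_or] at hq hq'
    obtain ⟨w, hw⟩ := (reaches_head_zero (by omega) _ hq.1 hq.2).trans
      (head_zero_reaches hm _ hq'.1 hq'.2)
    exact ⟨w, by simp [dfaRun_renumber, hw]⟩

end TernaryCounter

theorem stmt12 (ε : ℝ) (hε0 : 0 < ε) (hε1 : ε < 1) :
    ∃ c : ℝ, 0 < c ∧ ∃ n₀ : ℕ, ∀ n : ℕ, n₀ ≤ n →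
      ∃ (δ : Fin n → Fin 2 → Fin n) (S : Finset (Fin n)),
        (∃ w, dfaSync δ S w) ∧
        (∀ w, dfaSync δ S w →
          c * (3 - ε) ^ ((n : ℝ) / 3) ≤ (w.length : ℝ)) ∧
        -- at most 2 sink states
        (Finset.univ.filter fun q => dfaSink δ q).card ≤ 2 ∧
        -- transitive on the non-sink states
        (∀ q q' : Fin n, ¬ dfaSink δ q → ¬ dfaSink δ q' →
          ∃ w, dfaRun δ {q} w = {q'}) := by
  refine ⟨(3 ^ 9)⁻¹, by positivity, 36, fun n hn => ?_⟩
  obtain ⟨k, m, hm, hm4, hk, rfl⟩ :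
      ∃ k m, 1 < m ∧ m ≤ 4 ∧ 4 ≤ k ∧ n = 3 * k + 22 + m :=
    ⟨(n - 24) / 3, n - 22 - 3 * ((n - 24) / 3), by omega, by omega, by omega, by omega⟩
  obtain ⟨δ, S, hex, hlen, hrest⟩ := TernaryCounter.exists_dfa k m hm (by omega)
  refine ⟨δ, S, hex, fun w hw => ?_, hrest⟩
  have hw' : (3 : ℝ) ^ k ≤ w.length := by exact_mod_cast hlen w hw
  have hm' : (m : ℝ) ≤ 4 := by exact_mod_cast hm4
  refine le_trans ?_ hw'
  rw [inv_mul_le_iff₀ (by positivity), ← pow_add]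
  calc (3 - ε) ^ (((3 * k + 22 + m : ℕ) : ℝ) / 3)
      ≤ 3 ^ (((3 * k + 22 + m : ℕ) : ℝ) / 3) :=
        Real.rpow_le_rpow (by linarith) (by linarith) (by positivity)
    _ ≤ 3 ^ ((9 + k : ℕ) : ℝ) := by
        refine Real.rpow_le_rpow_of_exponent_le (by norm_num) ?_
        push_cast
        linarith
    _ = 3 ^ (9 + k) := Real.rpow_natCast _ _
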